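/- arXiv:2207.12213 — 4 statements merged into one kernel-verified Lean document; each statement's English description precedes it below -/
import Mathlib

section
/- Let M be a monotone model of dimension n, x ∈ {0,1}^n an instance, and δ ∈ (0,1]. If y ⊆ x is a δ-sufficient reason for x under M which is not a minimal δ-sufficient reason, then there exists an index i with y[i] ≠ ⊥ such that the partial instance y∖{i}, equal to y except that component i is set to ⊥, is also a δ-sufficient reason for x under M. -/
/-- A partial instance `y` is subsumed by a partial instance `y'`. -/
def Subsumes {α : Type} (y y' : α → Option Bool) : Prop :=
  ∀ i, y i ≠ none → y i = y' i

/-- A partial instance `y` is subsumed by a (total) instance `x`. -/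
def SubsumesT {α : Type} (y : α → Option Bool) (x : α → Bool) : Prop :=
  ∀ i, ∀ b : Bool, y i = some b → x i = b

/-- The set of completions of a partial instance `y`. -/
def Comp {α : Type} [Fintype α] [DecidableEq α] (y : α → Option Bool) :
    Finset (α → Bool) :=
  Finset.univ.filter (fun z => ∀ i, ∀ b : Bool, y i = some b → z i = b)

/-- The number of undefined components of a partial instance. -/
def numUndef {α : Type} [Fintype α] [DecidableEq α] (y : α → Option Bool) : ℕ :=
  (Finset.univ.filter (fun i => y i = none)).card

/-- `y` is a `δ`-sufficient reason for `x` under the model `M`. -/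
def IsDeltaSR {α : Type} [Fintype α] [DecidableEq α]
    (M : (α → Bool) → Bool) (x : α → Bool) (δ : ℝ) (y : α → Option Bool) : Prop :=
  SubsumesT y x ∧
    δ * 2 ^ numUndef y ≤ (((Comp y).filter (fun z => M z = M x)).card : ℝ)

section DeltaSR

variable {α : Type} [Fintype α] [DecidableEq α]

theorem mem_comp {y : α → Option Bool} {z : α → Bool} :
    z ∈ Comp y ↔ ∀ i, ∀ b : Bool, y i = some b → z i = b := by
  simp [Comp]

theorem mem_comp_update_some {y : α → Option Bool} {i : α} (hi : y i = none) {b : Bool}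
    {z : α → Bool} : z ∈ Comp (Function.update y i (some b)) ↔ z ∈ Comp y ∧ z i = b := by
  simp only [mem_comp]
  constructor
  · intro h
    refine ⟨fun j c hj => h j c ?_, h i b (by simp)⟩
    rw [Function.update_of_ne]
    · exact hj
    · rintro rfl
      simp [hi] at hj
  · rintro ⟨h, hb⟩ j c hj
    by_cases hji : j = i
    · subst hji
      simpa [hb] using hj
    · exact h j c (by simpa [hji] using hj)

theorem numUndef_update_some {y : α → Option Bool} {i : α} (hi : y i = none) (b : Bool) :
    numUndef y = numUndef (Function.update y i (some b)) + 1 := by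
  have h : Finset.univ.filter (fun j => Function.update y i (some b) j = none)
      = (Finset.univ.filter (fun j => y j = none)).erase i := by
    ext j
    by_cases hji : j = i
    · subst hji
      simp
    · simp [hji]
  unfold numUndef
  rw [h, Finset.card_erase_add_one]
  simp [hi]

theorem card_comp_filter_update_add (P : (α → Bool) → Prop) [DecidablePred P]
    {y : α → Option Bool} {i : α} (hi : y i = none) (b : Bool) :
    ((Comp (Function.update y i (some b))).filter P).card
      + ((Comp (Function.update y i (some !b))).filter P).card = ((Comp y).filter P).card := by
  rw [← Finset.card_filter_add_card_filter_not (s := (Comp y).filter P) (fun z => z i = b)]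
  congr 2
  · ext z
    simp only [Finset.mem_filter, mem_comp_update_some hi]
    tauto
  · ext z
    simp only [Finset.mem_filter, mem_comp_update_some hi, Bool.eq_not]
    tauto

/-- Fixing a free feature to the value `c` of a monotone model yields at least as many
completions classified as `c` as fixing it to the opposite value. -/
theorem card_comp_filter_update_not_le {M : (α → Bool) → Bool}
    (hmono : ∀ x z : α → Bool, (∀ i, x i ≤ z i) → M x ≤ M z)
    {y : α → Option Bool} {i : α} (hi : y i = none) (c : Bool) :
    ((Comp (Function.update y i (some !c))).filter (fun z => M z = c)).card
      ≤ ((Comp (Function.update y i (some c))).filter (fun z => M z = c)).card := by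
  refine Finset.card_le_card_of_injOn (fun z => Function.update z i c) ?_ ?_
  · intro z hz
    simp only [Finset.coe_filter, Set.mem_ofPred_eq, mem_comp_update_some hi] at hz ⊢
    obtain ⟨⟨hzy, hzi⟩, hMz⟩ := hz
    refine ⟨⟨mem_comp.2 fun j b hj => ?_, by simp⟩, ?_⟩
    · rw [Function.update_of_ne]
      · exact mem_comp.1 hzy j b hj
      · rintro rfl
        simp [hi] at hj
    · cases c
      · have h := hmono (Function.update z i false) z fun j => by
          by_cases hji : j = i
          · subst hji
            simp
          · simp [hji]
        rw [hMz] at h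
        exact le_antisymm h (Bool.false_le _)
      · have h := hmono z (Function.update z i true) fun j => by
          by_cases hji : j = i
          · subst hji
            simp
          · simp [hji]
        rw [hMz] at h
        exact le_antisymm (Bool.le_true _) h
  · intro z hz w hw hzw
    simp only [Finset.coe_filter, Set.mem_ofPred_eq, mem_comp_update_some hi] at hz hw
    ext1 j
    by_cases hji : j = i
    · rw [hji, hz.1.2, hw.1.2]
    · simpa [hji] using congrFun hzw j

/-- Fixing a feature whose value agrees with the classification preserves `δ`-sufficiency. -/
theorem IsDeltaSR.update_some {M : (α → Bool) → Bool}
    (hmono : ∀ x z : α → Bool, (∀ i, x i ≤ z i) → M x ≤ M z)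
    {x : α → Bool} {δ : ℝ} {y : α → Option Bool} (h : IsDeltaSR M x δ y) {i : α}
    (hx : x i = M x) : IsDeltaSR M x δ (Function.update y i (some (x i))) := by
  obtain ⟨hyx, hcard⟩ := h
  rcases hi : y i with _ | b
  · refine ⟨fun j b hj => ?_, ?_⟩
    · by_cases hji : j = i
      · subst hji
        simpa using hj
      · exact hyx j b (by simpa [hji] using hj)
    · rw [numUndef_update_some hi (x i), ← card_comp_filter_update_add _ hi (x i),
        pow_succ] at hcard
      have hle := card_comp_filter_update_not_le hmono hi (M x)
      rw [← hx] at hle hcard ⊢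
      have hle' := (Nat.cast_le (α := ℝ)).2 hle
      push_cast at hcard
      linarith
  · rw [hyx i b hi, ← hi, Function.update_eq_self]
    exact ⟨hyx, hcard⟩

/-- Freeing a feature whose value disagrees with the classification preserves
`δ`-sufficiency. -/
theorem IsDeltaSR.update_none {M : (α → Bool) → Bool}
    (hmono : ∀ x z : α → Bool, (∀ i, x i ≤ z i) → M x ≤ M z)
    {x : α → Bool} {δ : ℝ} {y : α → Option Bool} (h : IsDeltaSR M x δ y) {i : α}
    (hi : y i ≠ none) (hx : x i ≠ M x) : IsDeltaSR M x δ (Function.update y i none) := by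
  obtain ⟨hyx, hcard⟩ := h
  obtain ⟨b, hb⟩ := Option.ne_none_iff_exists'.1 hi
  have hbM : b = !M x := by
    rw [← hyx i b hb]
    exact Bool.eq_not.2 hx
  have hnone : Function.update y i none i = none := by simp
  have hy : Function.update (Function.update y i none) i (some !M x) = y := by
    rw [Function.update_idem, ← hbM, ← hb, Function.update_eq_self]
  refine ⟨fun j c hj => ?_, ?_⟩
  · by_cases hji : j = i
    · subst hji
      simp at hj
    · exact hyx j c (by simpa [hji] using hj)
  · have hle := card_comp_filter_update_not_le hmono hnone (M x)
    rw [numUndef_update_some hnone (!M x), ← card_comp_filter_update_add _ hnone (M x),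
      hy, pow_succ]
    rw [hy] at hle
    have hle' := (Nat.cast_le (α := ℝ)).2 hle
    push_cast
    linarith

theorem IsDeltaSR.fix_finset {M : (α → Bool) → Bool}
    (hmono : ∀ x z : α → Bool, (∀ i, x i ≤ z i) → M x ≤ M z)
    {x : α → Bool} {δ : ℝ} {y : α → Option Bool} (h : IsDeltaSR M x δ y) (T : Finset α)
    (hT : ∀ i ∈ T, x i = M x) :
    IsDeltaSR M x δ (fun i => if i ∈ T then some (x i) else y i) := by
  induction T using Finset.induction_on with
  | empty => simpa using h
  | insert i T _ ih =>
    convert (ih fun j hj => hT j (Finset.mem_insert_of_mem hj)).update_some hmono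
      (hT i (Finset.mem_insert_self i T)) using 1
    ext1 j
    by_cases hji : j = i
    · subst hji
      simp
    · simp [hji]

end DeltaSR

/-- For a monotone model, a non-minimal `δ`-sufficient reason can always be
shrunk by removing a single defined component. -/
theorem stmt1 {n : ℕ} (M : (Fin n → Bool) → Bool)
    (hmono : ∀ x z : Fin n → Bool, (∀ i, x i ≤ z i) → M x ≤ M z)
    (x : Fin n → Bool) (δ : ℝ) (hδ0 : 0 < δ) (hδ1 : δ ≤ 1)
    (y : Fin n → Option Bool)
    (hSR : IsDeltaSR M x δ y)
    (hnotmin : ∃ y' : Fin n → Option Bool,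
      Subsumes y' y ∧ y' ≠ y ∧ IsDeltaSR M x δ y') :
    ∃ i : Fin n, y i ≠ none ∧ IsDeltaSR M x δ (Function.update y i none) := by
  obtain ⟨y', hsub, hne, hSR'⟩ := hnotmin
  by_cases hex : ∃ i, y i ≠ none ∧ x i ≠ M x
  · obtain ⟨i, hi, hxi⟩ := hex
    exact ⟨i, hi, hSR.update_none hmono hi hxi⟩
  push Not at hex
  obtain ⟨i, hi⟩ := Function.ne_iff.1 hne
  have hi' : y' i = none := by
    by_contra hc
    exact hi (hsub i hc)
  refine ⟨i, fun hc => hi (hi'.trans hc.symm), ?_⟩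
  convert hSR'.fix_finset hmono (Finset.univ.filter fun j => y j ≠ none ∧ j ≠ i)
    (fun j hj => hex j (Finset.mem_filter.1 hj).2.1) using 1
  ext1 j
  by_cases hji : j = i
  · subst hji
    simp [hi']
  · rcases hj : y j with _ | b
    · have hj' : y' j = none := by
        by_contra hc
        exact hc ((hsub j hc).trans hj)
      simp [hji, hj, hj']
    · simp [hji, hj, hSR.1 j b hj]
end

section
/- There exist a dimension n, a decision tree T of dimension n, an instance x ∈ {0,1}^n, a value δ ∈ (0,1), and a partial instance y ⊆ x such that: y is a δ-sufficient reason for x under T; y is not a minimal δ-sufficient reason for x under T (some y' ⊊ y is a δ-sufficient reason); and yet for every index i with y[i] ≠ ⊥, the partial instance obtained from y by setting component i to ⊥ is not a δ-sufficient reason for x under T. (A witness is the dimension-3 tree of Example 2 with x = (1,1,1), y = x, and δ = 5/8.) -/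
/-- Binary decision trees whose internal nodes are labeled by features in `α`. -/
inductive DT (α : Type) : Type where
  | leaf (b : Bool)
  | node (i : α) (t0 t1 : DT α)

namespace DT

/-- Evaluation of a decision tree on an instance. -/
def eval {α : Type} : DT α → (α → Bool) → Bool
  | leaf b, _ => b
  | node i t0 t1, z => if z i then eval t1 z else eval t0 z

/-- The set of features appearing in a tree. -/
def vars {α : Type} [DecidableEq α] : DT α → Finset α
  | leaf _ => ∅
  | node i t0 t1 => insert i (vars t0 ∪ vars t1)

/-- No feature appears twice on any root-to-leaf path. -/
def ReadOnce {α : Type} [DecidableEq α] : DT α → Prop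
  | leaf _ => True
  | node i t0 t1 => i ∉ vars t0 ∧ i ∉ vars t1 ∧ ReadOnce t0 ∧ ReadOnce t1

/-- The number of internal nodes of a tree. -/
def internals {α : Type} : DT α → ℕ
  | leaf _ => 0
  | node _ t0 t1 => 1 + internals t0 + internals t1

/-- The total number of nodes (internal nodes and leaves) of a tree. -/
def size {α : Type} : DT α → ℕ
  | leaf _ => 1
  | node _ t0 t1 => 1 + size t0 + size t1

/-- The label sequences of all root-to-leaf paths of a tree. -/
def paths {α : Type} : DT α → List (List α)
  | leaf _ => [[]]
  | node i t0 t1 => (paths t0 ++ paths t1).map (fun p => i :: p)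

end DT

/-- `δ`-sufficiency for `δ = 5 / 8`, as an inequality between natural numbers. -/
theorem isDeltaSR_five_eighths_iff {α : Type} [Fintype α] [DecidableEq α]
    (M : (α → Bool) → Bool) (x : α → Bool) (y : α → Option Bool) :
    IsDeltaSR M x (5 / 8) y ↔
      SubsumesT y x ∧
        5 * 2 ^ numUndef y ≤ 8 * ((Comp y).filter (fun z => M z = M x)).card := by
  unfold IsDeltaSR
  rw [← Nat.cast_le (α := ℝ), div_mul_eq_mul_div, div_le_iff₀' (by norm_num)]
  push_cast
  rfl

/-- The decision tree that rejects exactly the instances with two true features out of three. -/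
def threeFeatureTree : DT (Fin 3) :=
  .node 0
    (.node 1 (.leaf true) (.node 2 (.leaf true) (.leaf false)))
    (.node 1 (.node 2 (.leaf true) (.leaf false)) (.node 2 (.leaf false) (.leaf true)))

/-- There is a decision tree `T`, an instance `x`, a `δ ∈ (0,1)` and a
`δ`-sufficient reason `y ⊆ x` under `T` which is not minimal, yet removing
any single defined component of `y` never yields a `δ`-sufficient reason. -/
theorem stmt4 :
    ∃ (n : ℕ) (T : DT (Fin n)) (x : Fin n → Bool) (δ : ℝ)
      (y : Fin n → Option Bool),
      T.ReadOnce ∧ 0 < δ ∧ δ < 1 ∧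
      IsDeltaSR T.eval x δ y ∧
      (∃ y' : Fin n → Option Bool,
        Subsumes y' y ∧ y' ≠ y ∧ IsDeltaSR T.eval x δ y') ∧
      (∀ i : Fin n, y i ≠ none →
        ¬ IsDeltaSR T.eval x δ (Function.update y i none)) := by
  refine ⟨3, threeFeatureTree, fun _ => true, 5 / 8, fun _ => some true, ?_, by norm_num,
    by norm_num, ?_, ⟨fun _ => none, by simp [Subsumes], fun h => by simpa using congrFun h 0, ?_⟩,
    ?_⟩
  · simp [threeFeatureTree, DT.ReadOnce, DT.vars]
  · rw [isDeltaSR_five_eighths_iff]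
    exact ⟨by simp [SubsumesT], by decide⟩
  · rw [isDeltaSR_five_eighths_iff]
    exact ⟨by simp [SubsumesT], by decide⟩
  · rintro i - h
    rw [isDeltaSR_five_eighths_iff] at h
    have h_few : ∀ i : Fin 3, ¬ 5 * 2 ^ numUndef (Function.update (fun _ => some true) i none) ≤
        8 * ((Comp (Function.update (fun _ => some true) i none)).filter
          (fun z => threeFeatureTree.eval z = threeFeatureTree.eval fun _ => true)).card := by
      decide
    exact h_few i h.2
end

section
/- For every n ≥ 1 and every integer c with 0 ≤ c < 2^n, there exists a decision tree T_c of dimension n with at most n internal nodes such that |{z ∈ {0,1}^n : T_c(z) = 1}| = c. -/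
namespace DT

/-- Relabel the features of a decision tree. -/
def map {α β : Type} (f : α → β) : DT α → DT β
  | leaf b => leaf b
  | node i t0 t1 => node (f i) (map f t0) (map f t1)

theorem eval_map {α β : Type} (f : α → β) (t : DT α) (z : β → Bool) :
    (t.map f).eval z = t.eval (z ∘ f) := by
  induction t with
  | leaf b => rfl
  | node i t0 t1 h0 h1 => simp [map, eval, h0, h1]

theorem vars_map {α β : Type} [DecidableEq α] [DecidableEq β] (f : α → β) (t : DT α) :
    (t.map f).vars = t.vars.image f := by
  induction t with
  | leaf b => rfl
  | node i t0 t1 h0 h1 => simp [map, vars, h0, h1, Finset.image_union]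

theorem internals_map {α β : Type} (f : α → β) (t : DT α) :
    (t.map f).internals = t.internals := by
  induction t with
  | leaf b => rfl
  | node i t0 t1 h0 h1 => simp [map, internals, h0, h1]

theorem ReadOnce.map {α β : Type} [DecidableEq α] [DecidableEq β] {f : α → β}
    (hf : Function.Injective f) {t : DT α} (ht : t.ReadOnce) : (t.map f).ReadOnce := by
  induction t with
  | leaf b => trivial
  | node i t0 t1 h0 h1 =>
    obtain ⟨hi0, hi1, ht0, ht1⟩ := ht
    refine ⟨?_, ?_, h0 ht0, h1 ht1⟩ <;> simpa [vars_map, hf.eq_iff]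

/-- The number of instances accepted by a decision tree. -/
def models {n : ℕ} (t : DT (Fin n)) : ℕ :=
  (Finset.univ.filter (fun z : Fin n → Bool => t.eval z = true)).card

theorem models_node_zero {n : ℕ} (b : Bool) (t : DT (Fin n)) :
    (node 0 (leaf b) (t.map Fin.succ)).models = (if b then 2 ^ n else 0) + t.models := by
  simp only [models, Finset.card_filter]
  rw [← (Fin.consEquiv (fun _ : Fin (n + 1) => Bool)).sum_comp, Fintype.sum_prod_type,
    Fintype.sum_bool, add_comm]
  cases b <;> simp [eval, eval_map, Function.comp_def]

theorem exists_readOnce_models_eq (n c : ℕ) (hc : c < 2 ^ n) :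
    ∃ T : DT (Fin n), T.ReadOnce ∧ T.internals ≤ n ∧ T.models = c := by
  induction n generalizing c with
  | zero =>
    obtain rfl : c = 0 := by simpa using hc
    exact ⟨leaf false, trivial, le_rfl, by simp [models, eval]⟩
  | succ n ih =>
    have extend (b : Bool) (d : ℕ) (hd : d < 2 ^ n) (hcd : (if b then 2 ^ n else 0) + d = c) :
        ∃ T : DT (Fin (n + 1)), T.ReadOnce ∧ T.internals ≤ n + 1 ∧ T.models = c := by
      obtain ⟨T, hT, hTn, rfl⟩ := ih d hd
      refine ⟨node 0 (leaf b) (T.map Fin.succ), ⟨?_, ?_, trivial, hT.map (Fin.succ_injective n)⟩,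
        ?_, (models_node_zero b T).trans hcd⟩
      · simp [vars]
      · simp [vars_map]
      · simp only [internals, internals_map]
        omega
    by_cases h : c < 2 ^ n
    · exact extend false c h (by simp)
    · exact extend true (c - 2 ^ n) (by omega) (by simp; omega)

end DT

/-- For every `n ≥ 1` and `0 ≤ c < 2^n` there is a decision tree of
dimension `n` with at most `n` internal nodes accepting exactly `c`
instances. -/
theorem stmt6 (n : ℕ) (hn : 1 ≤ n) (c : ℕ) (hc : c < 2 ^ n) :
    ∃ T : DT (Fin n), T.ReadOnce ∧ T.internals ≤ n ∧
      (Finset.univ.filter (fun z : Fin n → Bool => T.eval z = true)).card = c := DT.exists_readOnce_models_eq n c hc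
end

section
/- Fix δ ∈ (0,1). For every n ≥ 1 there exist a decision tree T of dimension n and an instance x† ∈ {0,1}^n such that: (1) | |{z ∈ {0,1}^n : T(z) = 1}|/2^n − δ | ≤ 1/2^n; and (2) for every partial instance y ⊆ x†, |{z ∈ Comp(y) : T(z) = 1}| / 2^{|y|_⊥} ≤ |{z ∈ {0,1}^n : T(z) = 1}| / 2^n. -/
/-- A Boolean function depending only on the features in `s` is computed by a read-once decision
tree whose features lie in `s`. -/
theorem DT.exists_readOnce_eval_eq {α : Type} [DecidableEq α] (s : Finset α)
    (f : (α → Bool) → Bool) (hf : ∀ z w, (∀ i ∈ s, z i = w i) → f z = f w) :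
    ∃ T : DT α, T.ReadOnce ∧ T.vars ⊆ s ∧ ∀ z, T.eval z = f z := by
  induction s using Finset.induction_on generalizing f with
  | empty =>
    exact ⟨.leaf (f fun _ => false), trivial, by simp [DT.vars],
      fun z => hf _ _ (by simp)⟩
  | insert a s ha ih =>
    have key : ∀ b : Bool, ∃ T : DT α, T.ReadOnce ∧ T.vars ⊆ s ∧
        ∀ z, T.eval z = f (Function.update z a b) := fun b =>
      ih (fun z => f (Function.update z a b)) fun z w h => hf _ _ fun i hi => by
        rcases Finset.mem_insert.1 hi with rfl | hi
        · simp
        · simp [Function.update_apply, h i hi]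
    obtain ⟨T0, r0, v0, e0⟩ := key false
    obtain ⟨T1, r1, v1, e1⟩ := key true
    refine ⟨.node a T0 T1, ⟨fun h => ha (v0 h), fun h => ha (v1 h), r0, r1⟩,
      Finset.insert_subset_insert _ (Finset.union_subset v0 v1), fun z => ?_⟩
    have hz : f z = f (Function.update z a (z a)) := by rw [Function.update_eq_self]
    rw [hz]
    cases h : z a <;> simp [DT.eval, h, e0, e1]

/-- A finite partial order has upper sets of every possible cardinality. -/
theorem exists_isUpperSet_card_eq {β : Type*} [PartialOrder β] [Fintype β] [DecidableEq β]
    (k : ℕ) (hk : k ≤ Fintype.card β) :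
    ∃ S : Finset β, IsUpperSet (S : Set β) ∧ S.card = k := by
  induction k with
  | zero => exact ⟨∅, by simpa using isUpperSet_empty, rfl⟩
  | succ k ih =>
    obtain ⟨S, hS, hc⟩ := ih (by omega)
    have hne : Sᶜ.Nonempty := by
      rw [← Finset.card_pos, Finset.card_compl]
      omega
    obtain ⟨m, hm⟩ := Sᶜ.exists_maximal hne
    have hmS : m ∉ S := by simpa using hm.prop
    refine ⟨insert m S, fun a b hab ha => ?_, by rw [Finset.card_insert_of_notMem hmS, hc]⟩
    rcases Finset.mem_insert.1 (Finset.mem_coe.1 ha) with rfl | ha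
    · by_cases hb : b ∈ S
      · exact Finset.mem_coe.2 (Finset.mem_insert_of_mem hb)
      · have hba : b ≤ a := hm.le_of_ge (by simpa using hb) hab
        simp [le_antisymm hba hab]
    · exact Finset.mem_coe.2 (Finset.mem_insert_of_mem (hS hab ha))

/-- Fixing some features to `false` does not increase the density of an upper set. -/
theorem card_comp_filter_mem_mul_le {α : Type} [Fintype α] [DecidableEq α]
    {S : Finset (α → Bool)} (hS : IsUpperSet (S : Set (α → Bool))) {y : α → Option Bool}
    (hy : SubsumesT y fun _ => false) :
    ((Comp y).filter (· ∈ S)).card * 2 ^ Fintype.card {i // y i ≠ none} ≤ S.card := by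
  have hfalse : ∀ z ∈ Comp y, ∀ i, y i ≠ none → z i = false := by
    intro z hz i hi
    obtain ⟨b, hb⟩ := Option.ne_none_iff_exists'.1 hi
    have hzb := (Finset.mem_filter.1 hz).2 i b hb
    exact hzb.trans (hy i b hb).symm
  have hcard : 2 ^ Fintype.card {i // y i ≠ none} =
      (Finset.univ : Finset ({i // y i ≠ none} → Bool)).card := by simp
  rw [hcard, ← Finset.card_product]
  refine Finset.card_le_card_of_injOn
    (fun p i => if h : y i ≠ none then p.2 ⟨i, h⟩ else p.1 i) ?_ ?_
  · rintro ⟨z, w⟩ hp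
    have hz := Finset.mem_filter.1 (Finset.mem_product.1 (Finset.mem_coe.1 hp)).1
    refine hS (fun i => ?_) hz.2
    by_cases h : y i ≠ none
    · simp [hfalse z hz.1 i h]
    · simp [h]
  · rintro ⟨z, w⟩ hp ⟨z', w'⟩ hp' heq
    have hz := (Finset.mem_filter.1 (Finset.mem_product.1 (Finset.mem_coe.1 hp)).1).1
    have hz' := (Finset.mem_filter.1 (Finset.mem_product.1 (Finset.mem_coe.1 hp')).1).1
    refine Prod.ext (funext fun i => ?_) (funext fun i => ?_)
    · by_cases h : y i ≠ none
      · exact (hfalse z hz i h).trans (hfalse z' hz' i h).symm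
      · simpa [h] using congrFun heq i
    · simpa [i.2] using congrFun heq i

theorem card_ne_none_add_numUndef {α : Type} [Fintype α] [DecidableEq α] (y : α → Option Bool) :
    Fintype.card {i // y i ≠ none} + numUndef y = Fintype.card α := by
  rw [Fintype.card_subtype, numUndef, add_comm, Finset.card_filter_add_card_filter_not,
    Finset.card_univ]

/-- Fix `δ ∈ (0,1)`. For every `n ≥ 1` there are a decision tree `T` of
dimension `n` and an instance `x†` such that the acceptance probability of a
uniformly random instance is within `1/2^n` of `δ`, and for every partial
instance `y ⊆ x†` the fraction of accepted completions of `y` is at most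
the overall acceptance probability. -/
theorem stmt7 (δ : ℝ) (hδ0 : 0 < δ) (hδ1 : δ < 1) (n : ℕ) (hn : 1 ≤ n) :
    ∃ (T : DT (Fin n)) (xd : Fin n → Bool),
      T.ReadOnce ∧
      |((Finset.univ.filter (fun z : Fin n → Bool => T.eval z = true)).card : ℝ)
          / 2 ^ n - δ| ≤ 1 / 2 ^ n ∧
      ∀ y : Fin n → Option Bool, SubsumesT y xd →
        (((Comp y).filter (fun z => T.eval z = true)).card : ℝ) / 2 ^ numUndef y
          ≤ ((Finset.univ.filter
                (fun z : Fin n → Bool => T.eval z = true)).card : ℝ) / 2 ^ n := by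
  have hpow : (0 : ℝ) < 2 ^ n := by positivity
  have hk : ⌊δ * 2 ^ n⌋₊ ≤ Fintype.card (Fin n → Bool) := by
    have h : ⌊δ * 2 ^ n⌋₊ ≤ ⌊((2 ^ n : ℕ) : ℝ)⌋₊ := Nat.floor_le_floor (by push_cast; nlinarith)
    rw [Nat.floor_natCast] at h
    simpa using h
  obtain ⟨S, hS, hc⟩ := exists_isUpperSet_card_eq _ hk
  obtain ⟨T, hT, -, hev⟩ := DT.exists_readOnce_eval_eq Finset.univ
    (fun z : Fin n → Bool => decide (z ∈ S)) fun z w h => by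
      rw [funext fun i => h i (Finset.mem_univ i)]
  refine ⟨T, fun _ => false, hT, ?_, fun y hy => ?_⟩
  · simp only [hev, decide_eq_true_eq, Finset.filter_univ_mem, hc]
    have h1 := Nat.floor_le (mul_nonneg hδ0.le hpow.le)
    have h2 := Nat.lt_floor_add_one (δ * 2 ^ n)
    rw [div_sub' hpow.ne', abs_div, abs_of_pos hpow]
    gcongr
    rw [abs_le]
    constructor <;> linarith
  · simp only [hev, decide_eq_true_eq, Finset.filter_univ_mem]
    have hle := card_comp_filter_mem_mul_le hS hy
    have hsum := card_ne_none_add_numUndef y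
    rw [Fintype.card_fin] at hsum
    rw [div_le_div_iff₀ (by positivity) hpow]
    have hle' := Nat.mul_le_mul_right (2 ^ numUndef y) hle
    rw [mul_assoc, ← pow_add, hsum] at hle'
    exact_mod_cast hle'
end
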